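/- Let n ≥ 1, let P, Q be real symmetric n×n matrices, let L be an invertible real n×n matrix, and write M = M_{P,L,Q}. Then for every Schwartz function u on ℝⁿ and all vectors z, ζ, t, τ ∈ ℝⁿ, 2 Re ⟨(⟨ζ,y⟩ − z·D_y)(Mu), i·M((⟨τ,x⟩ − t·D_x)u)⟩_{L²(ℝⁿ)} = (1/(2π))·[⟨ζ − Pz, L⁻¹(τ + Qt)⟩ + ⟨Lz, t⟩]·‖u‖²_{L²(ℝⁿ)}, where ⟨ζ,y⟩ denotes the operator of multiplication by the linear form y ↦ ⟨ζ,y⟩, z·D = Σⱼ zⱼ Dⱼ, and ⟨f,g⟩_{L²} = ∫ f(x) conj(g(x)) dx. -/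

import Mathlib

open MeasureTheory Matrix

noncomputable section

/-- The metaplectic-type integral operator `M_{P,L,Q}` (up to a unimodular constant phase). -/
def Mplq {n : ℕ} (P L Q : Matrix (Fin n) (Fin n) ℝ) (u : (Fin n → ℝ) → ℂ) :
    (Fin n → ℝ) → ℂ :=
  fun x => (Real.sqrt |L.det| : ℂ) *
    ∫ y : Fin n → ℝ,
      Complex.exp (Complex.I * (Real.pi : ℂ) *
        ((P.mulVec x ⬝ᵥ x - 2 * (L.mulVec x ⬝ᵥ y) + Q.mulVec y ⬝ᵥ y : ℝ) : ℂ)) * u y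

/-- The operator `Dⱼ = (1/(2πi)) ∂/∂xⱼ`. -/
def Dop {n : ℕ} (j : Fin n) (f : (Fin n → ℝ) → ℂ) : (Fin n → ℝ) → ℂ :=
  fun x => (1 / (2 * (Real.pi : ℂ) * Complex.I)) * fderiv ℝ f x (Pi.single j 1)

open SchwartzMap ComplexConjugate
open scoped LineDeriv FourierTransform SchwartzMap

variable {n : ℕ}

theorem hasTemperateGrowth_cexp_I_mul :
    (fun x : ℝ => Complex.exp (Complex.I * (x : ℂ))).HasTemperateGrowth := by
  have hd (x : ℝ) : HasDerivAt (fun x : ℝ => Complex.exp (Complex.I * (x : ℂ)))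
      (Complex.I * Complex.exp (Complex.I * (x : ℂ))) x := by
    simpa [mul_comm] using (((hasDerivAt_id (x : ℂ)).const_mul Complex.I).cexp).comp_ofReal
  have hit (k : ℕ) : iteratedDeriv k (fun x : ℝ => Complex.exp (Complex.I * (x : ℂ))) =
      fun x : ℝ => Complex.I ^ k * Complex.exp (Complex.I * (x : ℂ)) := by
    induction k with
    | zero => simp
    | succ k ih =>
      ext x
      rw [iteratedDeriv_succ, ih, ((hd x).const_mul _).deriv]
      ring
  refine ⟨?_, fun k => ⟨0, 1, fun x => ?_⟩⟩
  · exact (contDiff_const.mul Complex.ofRealCLM.contDiff).cexp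
  · rw [norm_iteratedFDeriv_eq_norm_iteratedDeriv, hit]
    simp [mul_comm Complex.I, Complex.norm_exp_ofReal_mul_I]

/-- The Gaussian chirp `x ↦ exp (iπ ⟨Q x, x⟩)`. -/
def chirp (Q : Matrix (Fin n) (Fin n) ℝ) (x : Fin n → ℝ) : ℂ :=
  Complex.exp (Complex.I * ((Real.pi * (Q.mulVec x ⬝ᵥ x) : ℝ) : ℂ))

theorem hasTemperateGrowth_dotProduct (a : Fin n → ℝ) :
    (fun x : Fin n → ℝ => a ⬝ᵥ x).HasTemperateGrowth :=
  (LinearMap.toContinuousLinearMap (dotProductBilin ℝ ℝ a)).hasTemperateGrowth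

theorem hasTemperateGrowth_quadratic (Q : Matrix (Fin n) (Fin n) ℝ) :
    (fun x : Fin n → ℝ => Q.mulVec x ⬝ᵥ x).HasTemperateGrowth := by
  have h (i : Fin n) : (fun x : Fin n → ℝ => x i).HasTemperateGrowth :=
    (ContinuousLinearMap.proj (R := ℝ) (φ := fun _ : Fin n => ℝ) i).hasTemperateGrowth
  exact .sum fun i _ => (hasTemperateGrowth_dotProduct (Q i)).mul (h i)

theorem hasTemperateGrowth_chirp (Q : Matrix (Fin n) (Fin n) ℝ) :
    (chirp Q).HasTemperateGrowth :=
  hasTemperateGrowth_cexp_I_mul.comp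
    ((Function.HasTemperateGrowth.const Real.pi).mul (hasTemperateGrowth_quadratic Q))

theorem chirp_mul_conj (Q : Matrix (Fin n) (Fin n) ℝ) (x : Fin n → ℝ) :
    chirp Q x * conj (chirp Q x) = 1 := by
  rw [Complex.mul_conj, Complex.normSq_eq_norm_sq, chirp, mul_comm, Complex.norm_exp_ofReal_mul_I]
  simp

theorem norm_chirp (Q : Matrix (Fin n) (Fin n) ℝ) (x : Fin n → ℝ) : ‖chirp Q x‖ = 1 := by
  rw [chirp, mul_comm, Complex.norm_exp_ofReal_mul_I]

theorem fderiv_chirp {Q : Matrix (Fin n) (Fin n) ℝ} (hQ : Q.IsSymm) (x m : Fin n → ℝ) :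
    fderiv ℝ (chirp Q) x m =
      2 * Real.pi * Complex.I * ((Q.mulVec x ⬝ᵥ m : ℝ) : ℂ) * chirp Q x := by
  have hdiff : DifferentiableAt ℝ (chirp Q) x :=
    (hasTemperateGrowth_chirp Q).1.differentiable (by simp) x
  rw [← hdiff.lineDeriv_eq_fderiv]
  refine HasLineDerivAt.lineDeriv ?_
  have hsym : Q.mulVec m ⬝ᵥ x = Q.mulVec x ⬝ᵥ m := by
    rw [dotProduct_comm, Matrix.dotProduct_mulVec, ← mulVec_transpose, hQ.eq]
  have hquad (s : ℝ) : Q.mulVec (x + s • m) ⬝ᵥ (x + s • m) =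
      Q.mulVec x ⬝ᵥ x + s * (2 * (Q.mulVec x ⬝ᵥ m)) + s ^ 2 * (Q.mulVec m ⬝ᵥ m) := by
    simp only [Matrix.mulVec_add, Matrix.mulVec_smul, add_dotProduct, dotProduct_add, smul_dotProduct,
      dotProduct_smul, smul_eq_mul, hsym]
    ring
  have hd : HasDerivAt (fun s : ℝ => Real.pi * (Q.mulVec (x + s • m) ⬝ᵥ (x + s • m)))
      (Real.pi * (2 * (Q.mulVec x ⬝ᵥ m))) 0 := by
    simp only [hquad]
    have := ((((hasDerivAt_id (0 : ℝ)).mul_const (2 * (Q.mulVec x ⬝ᵥ m))).const_add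
      (Q.mulVec x ⬝ᵥ x)).add (((hasDerivAt_id (0 : ℝ)).pow 2).mul_const
        (Q.mulVec m ⬝ᵥ m))).const_mul Real.pi
    simpa using! this
  have := (hd.ofReal_comp.const_mul Complex.I).cexp
  rw [HasLineDerivAt]
  convert! this using 1
  simp [chirp]
  ring

/-- Multiplication of a Schwartz function by the linear form `x ↦ ⟨a, x⟩`. -/
def lmul (a : Fin n → ℝ) (f : 𝓢(Fin n → ℝ, ℂ)) : 𝓢(Fin n → ℝ, ℂ) :=
  smulLeftCLM ℂ (fun x : Fin n → ℝ => a ⬝ᵥ x) f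

@[simp]
theorem lmul_apply (a : Fin n → ℝ) (f : 𝓢(Fin n → ℝ, ℂ)) (x : Fin n → ℝ) :
    lmul a f x = ((a ⬝ᵥ x : ℝ) : ℂ) * f x := by
  simp [lmul, hasTemperateGrowth_dotProduct a]

/-- Multiplication of a Schwartz function by a chirp. -/
def chirpMul (Q : Matrix (Fin n) (Fin n) ℝ) (f : 𝓢(Fin n → ℝ, ℂ)) : 𝓢(Fin n → ℝ, ℂ) :=
  smulLeftCLM ℂ (chirp Q) f

@[simp]
theorem chirpMul_apply (Q : Matrix (Fin n) (Fin n) ℝ) (f : 𝓢(Fin n → ℝ, ℂ)) (x : Fin n → ℝ) :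
    chirpMul Q f x = chirp Q x * f x := by
  simp [chirpMul, hasTemperateGrowth_chirp Q]

theorem lineDerivOp_lmul (b t : Fin n → ℝ) (f : 𝓢(Fin n → ℝ, ℂ)) :
    ∂_{t} (lmul b f) = ((b ⬝ᵥ t : ℝ) : ℂ) • f + lmul b (∂_{t} f) := by
  ext x
  have hc : (lmul b f : (Fin n → ℝ) → ℂ) = fun x => (b ⬝ᵥ x) • f x := by
    ext x; simp
  have hl := (LinearMap.toContinuousLinearMap (dotProductBilin ℝ ℝ b)).hasFDerivAt (x := x)
  have := (hl.smul (f.hasFDerivAt x)).fderiv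
  rw [lineDerivOp_apply_eq_fderiv, hc]
  erw [this]
  simp [lineDerivOp_apply_eq_fderiv, add_comm]

theorem lineDerivOp_chirpMul {Q : Matrix (Fin n) (Fin n) ℝ} (hQ : Q.IsSymm) (t : Fin n → ℝ)
    (f : 𝓢(Fin n → ℝ, ℂ)) :
    ∂_{t} (chirpMul Q f) = chirpMul Q (∂_{t} f) +
      (2 * Real.pi * Complex.I : ℂ) • lmul (Q.mulVec t) (chirpMul Q f) := by
  ext x
  have hc : (chirpMul Q f : (Fin n → ℝ) → ℂ) = fun x => chirp Q x * f x := by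
    ext x; simp
  have hdiff : DifferentiableAt ℝ (chirp Q) x :=
    (hasTemperateGrowth_chirp Q).1.differentiable (by simp) x
  have hsym : Q.mulVec t ⬝ᵥ x = Q.mulVec x ⬝ᵥ t := by
    rw [dotProduct_comm, Matrix.dotProduct_mulVec, ← mulVec_transpose, hQ.eq]
  rw [lineDerivOp_apply_eq_fderiv, hc, fderiv_fun_mul hdiff f.differentiableAt]
  simp [lineDerivOp_apply_eq_fderiv, fderiv_chirp hQ, hsym]
  ring

theorem lineDerivOp_lineDerivOp_comm (a t : Fin n → ℝ) (f : 𝓢(Fin n → ℝ, ℂ)) :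
    ∂_{a} (∂_{t} f) = ∂_{t} (∂_{a} f) := by
  ext x
  have h (p q : Fin n → ℝ) : ∂_{p} (∂_{q} f) x = fderiv ℝ (fderiv ℝ f) x p q := by
    rw [lineDerivOp_apply_eq_fderiv]
    have : ⇑(∂_{q} f : 𝓢(Fin n → ℝ, ℂ)) = fun y => fderiv ℝ f y q := rfl
    have hd : DifferentiableAt ℝ (fderiv ℝ f) x :=
      (fderivCLM ℝ (Fin n → ℝ) ℂ f).differentiableAt
    rw [this, fderiv_clm_apply hd (by fun_prop)]
    simp
  rw [h, h]
  exact ((f.smooth 2).contDiffAt.isSymmSndFDerivAt (by simp)).eq a t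

/-- The Fourier transform on Schwartz functions of `Fin n → ℝ`, with kernel
`exp (-2πi ⟨ξ, y⟩)`. -/
def piFourier (f : 𝓢(Fin n → ℝ, ℂ)) : 𝓢(Fin n → ℝ, ℂ) :=
  compCLMOfContinuousLinearEquiv ℂ (EuclideanSpace.equiv (Fin n) ℝ).symm
    (𝓕 (compCLMOfContinuousLinearEquiv ℂ (EuclideanSpace.equiv (Fin n) ℝ) f))

theorem piFourier_apply (f : 𝓢(Fin n → ℝ, ℂ)) (ξ : Fin n → ℝ) :
    piFourier f ξ =
      ∫ y : Fin n → ℝ, Complex.exp (((-2 * Real.pi * (ξ ⬝ᵥ y) : ℝ) : ℂ) * Complex.I) * f y := by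
  rw [piFourier, compCLMOfContinuousLinearEquiv_apply, Function.comp_apply, fourier_coe,
    Real.fourier_eq', ← (PiLp.volume_preserving_toLp (Fin n)).integral_comp
      (MeasurableEquiv.toLp 2 (Fin n → ℝ)).measurableEmbedding]
  refine integral_congr_ae (.of_forall fun y => ?_)
  simp [EuclideanSpace.inner_eq_star_dotProduct]
  rfl

theorem piFourier_add (f g : 𝓢(Fin n → ℝ, ℂ)) :
    piFourier (f + g) = piFourier f + piFourier g := by
  simp [piFourier, FourierTransform.fourier_add]

theorem piFourier_smul (c : ℂ) (f : 𝓢(Fin n → ℝ, ℂ)) :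
    piFourier (c • f) = c • piFourier f := by
  simp [piFourier, FourierTransform.fourier_smul]

theorem lineDerivOp_piFourier (f : 𝓢(Fin n → ℝ, ℂ)) (m : Fin n → ℝ) :
    ∂_{m} (piFourier f) = -(2 * Real.pi * Complex.I : ℂ) • piFourier (lmul m f) := by
  rw [piFourier, lineDerivOp_compCLMOfContinuousLinearEquiv, lineDerivOp_fourier_eq,
    FourierTransform.fourier_smul, map_smul, piFourier]
  congr 3
  ext x
  have : (inner ℝ · ((EuclideanSpace.equiv (Fin n) ℝ).symm m)).HasTemperateGrowth := by fun_prop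
  rw [smulLeftCLM_apply_apply this]
  simp [EuclideanSpace.inner_eq_star_dotProduct]
  exact Or.inl rfl

theorem piFourier_lineDerivOp (f : 𝓢(Fin n → ℝ, ℂ)) (m : Fin n → ℝ) :
    piFourier (∂_{m} f) = (2 * Real.pi * Complex.I : ℂ) • lmul m (piFourier f) := by
  have h := lineDerivOp_compCLMOfContinuousLinearEquiv ℂ
    ((EuclideanSpace.equiv (Fin n) ℝ).symm m) (EuclideanSpace.equiv (Fin n) ℝ) f
  rw [ContinuousLinearEquiv.apply_symm_apply] at h
  rw [piFourier, ← h, fourier_lineDerivOp_eq, map_smul]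
  congr 1
  ext x
  have : (inner ℝ · ((EuclideanSpace.equiv (Fin n) ℝ).symm m)).HasTemperateGrowth := by fun_prop
  rw [compCLMOfContinuousLinearEquiv_apply, Function.comp_apply, smulLeftCLM_apply_apply this]
  simp [EuclideanSpace.inner_eq_star_dotProduct, piFourier]

/-- The `L²` pairing `∫ f conj g` of Schwartz functions. -/
def l2 (f g : 𝓢(Fin n → ℝ, ℂ)) : ℂ := ∫ x, f x * conj (g x)

theorem l2_piFourier (f g : 𝓢(Fin n → ℝ, ℂ)) : l2 (piFourier f) (piFourier g) = l2 f g := by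
  have h := integral_inner_fourier_fourier
    (compCLMOfContinuousLinearEquiv ℂ (EuclideanSpace.equiv (Fin n) ℝ) g)
    (compCLMOfContinuousLinearEquiv ℂ (EuclideanSpace.equiv (Fin n) ℝ) f)
  rw [← (PiLp.volume_preserving_toLp (Fin n)).integral_comp
      (MeasurableEquiv.toLp 2 (Fin n → ℝ)).measurableEmbedding,
    ← (PiLp.volume_preserving_toLp (Fin n)).integral_comp
      (MeasurableEquiv.toLp 2 (Fin n → ℝ)).measurableEmbedding] at h
  simpa [l2, piFourier, RCLike.inner_apply] using! h

/-- The real bilinear map `(z, w) ↦ z * conj w`. -/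
def mulConjCLM : ℂ →L[ℝ] ℂ →L[ℝ] ℂ :=
  ((ContinuousLinearMap.mul ℝ ℂ).flip.comp (Complex.conjCLE : ℂ →L[ℝ] ℂ)).flip

@[simp]
theorem mulConjCLM_apply (z w : ℂ) : mulConjCLM z w = z * conj w := by
  simp [mulConjCLM, mul_comm]

theorem integrable_mul_conj (f g : 𝓢(Fin n → ℝ, ℂ)) :
    Integrable (fun x => f x * conj (g x)) := by
  simpa using! (pairing mulConjCLM f g).integrable (μ := volume)

theorem l2_add_left (f g h : 𝓢(Fin n → ℝ, ℂ)) : l2 (f + g) h = l2 f h + l2 g h := by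
  simp only [l2, _root_.add_apply, add_mul]
  exact integral_add (integrable_mul_conj f h) (integrable_mul_conj g h)

theorem l2_smul_left (c : ℂ) (f g : 𝓢(Fin n → ℝ, ℂ)) : l2 (c • f) g = c * l2 f g := by
  simp only [l2, _root_.smul_apply, smul_eq_mul, mul_assoc]
  exact integral_const_mul _ _

theorem conj_l2 (f g : 𝓢(Fin n → ℝ, ℂ)) : conj (l2 f g) = l2 g f := by
  simp only [l2, ← integral_conj, map_mul, Complex.conj_conj, mul_comm]

theorem l2_add_right (f g h : 𝓢(Fin n → ℝ, ℂ)) : l2 f (g + h) = l2 f g + l2 f h := by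
  simp only [← conj_l2 _ f, l2_add_left, map_add]

theorem l2_smul_right (c : ℂ) (f g : 𝓢(Fin n → ℝ, ℂ)) : l2 f (c • g) = conj c * l2 f g := by
  simp only [← conj_l2 _ f, l2_smul_left, map_mul]

theorem l2_self (f : 𝓢(Fin n → ℝ, ℂ)) : l2 f f = ((∫ x, ‖f x‖ ^ 2 : ℝ) : ℂ) := by
  simp only [l2, Complex.mul_conj, Complex.normSq_eq_norm_sq]
  exact integral_ofReal

theorem l2_lmul_left (a : Fin n → ℝ) (f g : 𝓢(Fin n → ℝ, ℂ)) :
    l2 (lmul a f) g = l2 f (lmul a g) := by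
  simp only [l2, lmul_apply, map_mul, Complex.conj_ofReal]
  congr 1
  ext x
  ring

theorem l2_lineDerivOp_right (f g : 𝓢(Fin n → ℝ, ℂ)) (a : Fin n → ℝ) :
    l2 f (∂_{a} g) = -l2 (∂_{a} f) g := by
  simpa [l2] using
    integral_bilinear_lineDerivOp_right_eq_neg_left (μ := volume) f g mulConjCLM a

theorem two_re_l2_lmul_lineDerivOp (b t : Fin n → ℝ) (f : 𝓢(Fin n → ℝ, ℂ)) :
    2 * (l2 (lmul b f) (∂_{t} f)).re = -((b ⬝ᵥ t) * ∫ x, ‖f x‖ ^ 2) := by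
  have h := l2_lineDerivOp_right (lmul b f) f t
  have hc : l2 (lmul b (∂_{t} f)) f = conj (l2 (lmul b f) (∂_{t} f)) := by
    rw [conj_l2, l2_lmul_left]
  rw [lineDerivOp_lmul, l2_add_left, l2_smul_left, l2_self, hc] at h
  have := congrArg Complex.re h
  simp only [Complex.neg_re, Complex.add_re, Complex.conj_re, ← Complex.ofReal_mul,
    Complex.ofReal_re] at this
  linarith

theorem im_l2_lineDerivOp_lineDerivOp (a t : Fin n → ℝ) (f : 𝓢(Fin n → ℝ, ℂ)) :
    (l2 (∂_{a} f) (∂_{t} f)).im = 0 := by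
  rw [← Complex.conj_eq_iff_im, conj_l2, l2_lineDerivOp_right, l2_lineDerivOp_right,
    lineDerivOp_lineDerivOp_comm]

theorem im_l2_lmul_lmul (a b : Fin n → ℝ) (f : 𝓢(Fin n → ℝ, ℂ)) :
    (l2 (lmul a f) (lmul b f)).im = 0 := by
  rw [← Complex.conj_eq_iff_im, conj_l2]
  simp only [l2, lmul_apply, map_mul, Complex.conj_ofReal]
  congr 1
  ext x
  ring

/-- The first-order operator `f ↦ ⟨b, x⟩ f + (a · D) f`. -/
def phaseOp (b a : Fin n → ℝ) (f : 𝓢(Fin n → ℝ, ℂ)) : 𝓢(Fin n → ℝ, ℂ) :=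
  lmul b f + (1 / (2 * (Real.pi : ℂ) * Complex.I)) • ∂_{a} f

theorem two_re_l2_phaseOp (b a s t : Fin n → ℝ) (f : 𝓢(Fin n → ℝ, ℂ)) :
    2 * (l2 (phaseOp b a f) (Complex.I • phaseOp s (-t) f)).re =
      1 / (2 * Real.pi) * (a ⬝ᵥ s + b ⬝ᵥ t) * ∫ x, ‖f x‖ ^ 2 := by
  have h1 := two_re_l2_lmul_lineDerivOp b (-t) f
  have h2 := two_re_l2_lmul_lineDerivOp s a f
  have h3 := im_l2_lineDerivOp_lineDerivOp a (-t) f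
  have h4 := im_l2_lmul_lmul b s f
  have h5 : (l2 (∂_{a} f) (lmul s f)).re = (l2 (lmul s f) (∂_{a} f)).re := by
    rw [← conj_l2, Complex.conj_re]
  have hk : (1 / (2 * (Real.pi : ℂ) * Complex.I)) =
      ((1 / (2 * Real.pi) : ℝ) : ℂ) * -Complex.I := by
    have : (Real.pi : ℂ) ≠ 0 := by exact_mod_cast Real.pi_ne_zero
    push_cast
    field_simp
    simp
  simp only [phaseOp, hk, l2_smul_right, l2_add_left, l2_add_right, l2_smul_left]
  generalize 1 / (2 * Real.pi) = k
  simp only [map_mul, map_neg, Complex.conj_I, Complex.conj_ofReal, Complex.add_re, Complex.add_im,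
    Complex.mul_re, Complex.mul_im, Complex.neg_re, Complex.neg_im, Complex.I_re, Complex.I_im,
    Complex.ofReal_re, Complex.ofReal_im, h3, h4, h5]
  rw [dotProduct_neg] at h1
  rw [dotProduct_comm a s]
  linear_combination (-k) * h1 * (-1) - k * h2

theorem phaseOp_apply (b a : Fin n → ℝ) (f : 𝓢(Fin n → ℝ, ℂ)) (x : Fin n → ℝ) :
    phaseOp b a f x = ((b ⬝ᵥ x : ℝ) : ℂ) * f x +
      1 / (2 * (Real.pi : ℂ) * Complex.I) * fderiv ℝ f x a := by
  simp [phaseOp, lineDerivOp_apply_eq_fderiv]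

theorem sum_mul_Dop (z : Fin n → ℝ) (f : (Fin n → ℝ) → ℂ) (x : Fin n → ℝ) :
    ∑ j, ((z j : ℝ) : ℂ) * Dop j f x =
      1 / (2 * (Real.pi : ℂ) * Complex.I) * fderiv ℝ f x z := by
  conv_rhs => rw [pi_eq_sum_univ' z, map_sum, Finset.mul_sum]
  refine Finset.sum_congr rfl fun j _ => ?_
  rw [map_smul, Dop, Complex.real_smul]
  ring

theorem phaseOp_neg_apply (τ t : Fin n → ℝ) (f : 𝓢(Fin n → ℝ, ℂ)) :
    (fun x => ((τ ⬝ᵥ x : ℝ) : ℂ) * f x - ∑ j, ((t j : ℝ) : ℂ) * Dop j (⇑f) x) =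
      ⇑(phaseOp τ (-t) f) := by
  ext x
  rw [sum_mul_Dop, phaseOp_apply, map_neg]
  ring

theorem Mplq_apply (P L Q : Matrix (Fin n) (Fin n) ℝ) (f : 𝓢(Fin n → ℝ, ℂ)) (x : Fin n → ℝ) :
    Mplq P L Q f x =
      (Real.sqrt |L.det| : ℂ) * (chirp P x * piFourier (chirpMul Q f) (L.mulVec x)) := by
  rw [Mplq, piFourier_apply, ← integral_const_mul (chirp P x)]
  congr 1
  refine integral_congr_ae (.of_forall fun y => ?_)
  beta_reduce
  rw [chirpMul_apply, chirp, chirp, ← mul_assoc, ← mul_assoc, ← Complex.exp_add, ← Complex.exp_add]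
  congr 2
  push_cast
  ring

theorem chirpMul_phaseOp {Q : Matrix (Fin n) (Fin n) ℝ} (hQ : Q.IsSymm) (τ t : Fin n → ℝ)
    (f : 𝓢(Fin n → ℝ, ℂ)) :
    chirpMul Q (phaseOp τ (-t) f) = phaseOp (τ + Q.mulVec t) (-t) (chirpMul Q f) := by
  have hd := lineDerivOp_chirpMul hQ (-t) f
  have hpi : (Real.pi : ℂ) ≠ 0 := by exact_mod_cast Real.pi_ne_zero
  ext x
  have hx := congrArg (fun g : 𝓢(Fin n → ℝ, ℂ) => g x) hd
  simp only [_root_.add_apply, _root_.smul_apply, lmul_apply, chirpMul_apply, smul_eq_mul,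
    lineDerivOp_apply_eq_fderiv] at hx
  rw [chirpMul_apply, phaseOp_apply, phaseOp_apply, hx, Matrix.mulVec_neg, neg_dotProduct,
    add_dotProduct, chirpMul_apply]
  have := Complex.I_ne_zero
  push_cast
  field_simp
  ring

theorem fderiv_Mplq {P : Matrix (Fin n) (Fin n) ℝ} (hP : P.IsSymm)
    (L Q : Matrix (Fin n) (Fin n) ℝ) (f : 𝓢(Fin n → ℝ, ℂ)) (x z : Fin n → ℝ) :
    fderiv ℝ (Mplq P L Q f) x z =
      2 * Real.pi * Complex.I * (Real.sqrt |L.det| : ℂ) * chirp P x *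
        (((P.mulVec x ⬝ᵥ z : ℝ) : ℂ) * piFourier (chirpMul Q f) (L.mulVec x) -
          piFourier (lmul (L.mulVec z) (chirpMul Q f)) (L.mulVec x)) := by
  have hM : Mplq P L Q f = fun x =>
      (Real.sqrt |L.det| : ℂ) * (chirp P x * piFourier (chirpMul Q f) (L.mulVec x)) := by
    ext x
    exact Mplq_apply P L Q f x
  have hL : HasFDerivAt (fun x => L.mulVec x) (LinearMap.toContinuousLinearMap L.mulVecLin) x :=
    (LinearMap.toContinuousLinearMap L.mulVecLin).hasFDerivAt
  have hF := ((piFourier (chirpMul Q f)).hasFDerivAt (L.mulVec x)).comp x hL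
  have hchirp : DifferentiableAt ℝ (chirp P) x :=
    (hasTemperateGrowth_chirp P).1.differentiable (by simp) x
  have hd := ((hchirp.hasFDerivAt.mul hF).const_mul (Real.sqrt |L.det| : ℂ)).fderiv
  have hv : fderiv ℝ (piFourier (chirpMul Q f)) (L.mulVec x) (L.mulVec z) =
      -(2 * Real.pi * Complex.I : ℂ) *
        piFourier (lmul (L.mulVec z) (chirpMul Q f)) (L.mulVec x) := by
    rw [← lineDerivOp_apply_eq_fderiv, lineDerivOp_piFourier, _root_.smul_apply, smul_eq_mul]
  rw [hM]
  refine (congrArg (fun A => A z) hd).trans ?_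
  simp [fderiv_chirp hP, hv]
  ring

theorem phaseOp_Mplq {P L : Matrix (Fin n) (Fin n) ℝ} (hP : P.IsSymm) (hL : IsUnit L.det)
    (Q : Matrix (Fin n) (Fin n) ℝ) (f : 𝓢(Fin n → ℝ, ℂ)) (z ζ y : Fin n → ℝ) :
    ((ζ ⬝ᵥ y : ℝ) : ℂ) * Mplq P L Q f y - ∑ j, ((z j : ℝ) : ℂ) * Dop j (Mplq P L Q f) y =
      (Real.sqrt |L.det| : ℂ) * (chirp P y *
        piFourier (phaseOp (L.mulVec z) ((L⁻¹)ᵀ.mulVec (ζ - P.mulVec z)) (chirpMul Q f))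
          (L.mulVec y)) := by
  have hpi : (Real.pi : ℂ) ≠ 0 := by exact_mod_cast Real.pi_ne_zero
  have hI := Complex.I_ne_zero
  have hdot : (L⁻¹)ᵀ.mulVec (ζ - P.mulVec z) ⬝ᵥ L.mulVec y = ζ ⬝ᵥ y - P.mulVec y ⬝ᵥ z := by
    rw [Matrix.mulVec_transpose, ← Matrix.dotProduct_mulVec, Matrix.mulVec_mulVec,
      Matrix.nonsing_inv_mul _ hL, Matrix.one_mulVec, sub_dotProduct, dotProduct_comm _ z,
      Matrix.dotProduct_mulVec, ← Matrix.mulVec_transpose, hP.eq, dotProduct_comm _ y]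
  rw [sum_mul_Dop, fderiv_Mplq hP, Mplq_apply, phaseOp, piFourier_add, piFourier_smul,
    piFourier_lineDerivOp]
  simp only [_root_.add_apply, _root_.smul_apply, lmul_apply, smul_eq_mul, hdot]
  push_cast
  field_simp
  ring

theorem abs_det_mul_integral_comp_mulVec {L : Matrix (Fin n) (Fin n) ℝ} (hL : IsUnit L.det)
    (F : (Fin n → ℝ) → ℂ) :
    ((|L.det| : ℝ) : ℂ) * ∫ y, F (L.mulVec y) = ∫ x, F x := by
  have hemb : MeasurableEmbedding (Matrix.toLin' L) :=
    (LinearMap.continuous_on_pi _).measurableEmbedding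
      (Matrix.mulVec_injective_iff_isUnit.2 ((Matrix.isUnit_iff_isUnit_det L).2 hL))
  have h := hemb.integral_map (μ := volume) F
  rw [Real.map_matrix_volume_pi_eq_smul_volume_pi hL.ne_zero, integral_smul_measure,
    ENNReal.toReal_ofReal (abs_nonneg _), abs_inv, Complex.real_smul] at h
  simp only [Matrix.toLin'_apply] at h
  rw [← h, ← mul_assoc, ← Complex.ofReal_mul, mul_inv_cancel₀ (abs_ne_zero.2 hL.ne_zero),
    Complex.ofReal_one, one_mul]

theorem bracket_identity_Mplq {n : ℕ} (hn : 1 ≤ n)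
    (P L Q : Matrix (Fin n) (Fin n) ℝ)
    (hP : P.IsSymm) (hQ : Q.IsSymm) (hL : IsUnit L.det)
    (u : SchwartzMap (Fin n → ℝ) ℂ) (z ζ t τ : Fin n → ℝ) :
    2 * (∫ y : Fin n → ℝ,
        (((ζ ⬝ᵥ y : ℝ) : ℂ) * Mplq P L Q (⇑u) y
            - ∑ j, ((z j : ℝ) : ℂ) * Dop j (Mplq P L Q ⇑u) y) *
          (starRingEnd ℂ) (Complex.I *
            Mplq P L Q (fun x => ((τ ⬝ᵥ x : ℝ) : ℂ) * u x
              - ∑ j, ((t j : ℝ) : ℂ) * Dop j (⇑u) x) y)).re =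
      (1 / (2 * Real.pi)) *
        (((ζ - P.mulVec z) ⬝ᵥ (L⁻¹.mulVec (τ + Q.mulVec t))) + (L.mulVec z ⬝ᵥ t)) *
        ∫ x, ‖u x‖ ^ 2 := by
  set v := chirpMul Q u with hv
  set A := phaseOp (L.mulVec z) ((L⁻¹)ᵀ.mulVec (ζ - P.mulVec z)) v with hA
  set B := phaseOp (τ + Q.mulVec t) (-t) v with hB
  have hint : (∫ y : Fin n → ℝ,
        (((ζ ⬝ᵥ y : ℝ) : ℂ) * Mplq P L Q (⇑u) y
            - ∑ j, ((z j : ℝ) : ℂ) * Dop j (Mplq P L Q ⇑u) y) *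
          (starRingEnd ℂ) (Complex.I *
            Mplq P L Q (fun x => ((τ ⬝ᵥ x : ℝ) : ℂ) * u x
              - ∑ j, ((t j : ℝ) : ℂ) * Dop j (⇑u) x) y)) = l2 A (Complex.I • B) := by
    rw [← l2_piFourier, l2, ← abs_det_mul_integral_comp_mulVec hL
        (fun x => piFourier A x * conj (piFourier (Complex.I • B) x)), ← integral_const_mul]
    refine integral_congr_ae (.of_forall fun y => ?_)
    beta_reduce
    have hsq : (Real.sqrt |L.det| : ℂ) * (Real.sqrt |L.det| : ℂ) = ((|L.det| : ℝ) : ℂ) := by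
      rw [← Complex.ofReal_mul, Real.mul_self_sqrt (abs_nonneg _)]
    rw [phaseOp_neg_apply, phaseOp_Mplq hP hL, Mplq_apply, chirpMul_phaseOp hQ, ← hv, ← hA, ← hB,
      piFourier_smul, _root_.smul_apply, smul_eq_mul]
    simp only [map_mul, Complex.conj_ofReal]
    linear_combination ((|L.det| : ℝ) : ℂ) * piFourier A (L.mulVec y) * conj Complex.I *
      conj (piFourier B (L.mulVec y)) * chirp_mul_conj P y + chirp P y * conj (chirp P y) *
      piFourier A (L.mulVec y) * conj Complex.I * conj (piFourier B (L.mulVec y)) * hsq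
  have hnorm : ∫ x, ‖v x‖ ^ 2 = ∫ x, ‖u x‖ ^ 2 := by
    simp [hv, norm_chirp]
  rw [hint, two_re_l2_phaseOp, hnorm, Matrix.mulVec_transpose, ← Matrix.dotProduct_mulVec]

end
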